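/- For Z ∈ 𝔤₁ and X₁, X₂ ∈ 𝔤₋₁, the identities [[Z, X₁], X₂] = B(Z, X₁)·X₂ − 3·B(Z, X₂)·X₁ and [Z, [X₁, X₂]] = 4·(B(Z, X₁)·X₂ − B(Z, X₂)·X₁) hold, where B(Z, X) = Z·X (the product of the row vector Z with the column vector X). -/

import Mathlib

open Matrix

noncomputable section

/-- The paper's 7×7 block-matrix presentation of the split Lie algebra of type G₂,
parametrized by `A ∈ gl(2,ℝ)`, column vectors `X Y ∈ ℝ²`, row vectors `Z W ∈ (ℝ²)*`,
and scalars `r s ∈ ℝ`. -/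
def g2mat (A : Matrix (Fin 2) (Fin 2) ℝ) (X Y Z W : Fin 2 → ℝ) (r s : ℝ) :
    Matrix (Fin 7) (Fin 7) ℝ :=
  !![A 0 0 + A 1 1, Z 0, Z 1, s, W 0, W 1, 0;
     X 0, A 0 0, A 0 1, -(Real.sqrt 2 * Z 1), 0, -(s / Real.sqrt 2), -W 0;
     X 1, A 1 0, A 1 1, Real.sqrt 2 * Z 0, s / Real.sqrt 2, 0, -W 1;
     r, -(Real.sqrt 2 * X 1), Real.sqrt 2 * X 0, 0, -(Real.sqrt 2 * Z 1), Real.sqrt 2 * Z 0, s;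
     Y 0, 0, r / Real.sqrt 2, -(Real.sqrt 2 * X 1), -A 0 0, -A 1 0, -Z 0;
     Y 1, -(r / Real.sqrt 2), 0, Real.sqrt 2 * X 0, -A 0 1, -A 1 1, -Z 1;
     0, -Y 0, -Y 1, r, -X 0, -X 1, -(A 0 0 + A 1 1)]

/-- The split G₂ Lie algebra 𝔤 as a set of 7×7 real matrices. -/
def g2set : Set (Matrix (Fin 7) (Fin 7) ℝ) :=
  {M | ∃ A X Y Z W r s, M = g2mat A X Y Z W r s}

/-- The graded piece 𝔤₋₃ (parameter `Y`). -/
def gm3 (Y : Fin 2 → ℝ) : Matrix (Fin 7) (Fin 7) ℝ := g2mat 0 0 Y 0 0 0 0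
/-- The graded piece 𝔤₋₂ (parameter `r`). -/
def gm2 (r : ℝ) : Matrix (Fin 7) (Fin 7) ℝ := g2mat 0 0 0 0 0 r 0
/-- The graded piece 𝔤₋₁ (parameter `X`). -/
def gm1 (X : Fin 2 → ℝ) : Matrix (Fin 7) (Fin 7) ℝ := g2mat 0 X 0 0 0 0 0
/-- The graded piece 𝔤₀ (parameter `A`). -/
def g0m (A : Matrix (Fin 2) (Fin 2) ℝ) : Matrix (Fin 7) (Fin 7) ℝ := g2mat A 0 0 0 0 0 0
/-- The graded piece 𝔤₁ (parameter `Z`). -/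
def g1m (Z : Fin 2 → ℝ) : Matrix (Fin 7) (Fin 7) ℝ := g2mat 0 0 0 Z 0 0 0
/-- The graded piece 𝔤₂ (parameter `s`). -/
def g2m (s : ℝ) : Matrix (Fin 7) (Fin 7) ℝ := g2mat 0 0 0 0 0 0 s
/-- The graded piece 𝔤₃ (parameter `W`). -/
def g3m (W : Fin 2 → ℝ) : Matrix (Fin 7) (Fin 7) ℝ := g2mat 0 0 0 0 W 0 0

/-- The pairing B(M,N) = (1/6)·tr(MN). -/
def Bpair (M N : Matrix (Fin 7) (Fin 7) ℝ) : ℝ := (1 / 6 : ℝ) * (M * N).trace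

set_option maxHeartbeats 8000000 in
/-- The identities [[Z,X₁],X₂] = B(Z,X₁)X₂ − 3B(Z,X₂)X₁ and
[Z,[X₁,X₂]] = 4(B(Z,X₁)X₂ − B(Z,X₂)X₁), where B(Z,X) = ZX. -/
theorem bracket_identities_g1_gm1 :
    ∀ Z X₁ X₂ : Fin 2 → ℝ,
      ((g1m Z * gm1 X₁ - gm1 X₁ * g1m Z) * gm1 X₂ -
        gm1 X₂ * (g1m Z * gm1 X₁ - gm1 X₁ * g1m Z)
          = gm1 ((Z 0 * X₁ 0 + Z 1 * X₁ 1) • X₂ - (3 * (Z 0 * X₂ 0 + Z 1 * X₂ 1)) • X₁)) ∧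
      (g1m Z * (gm1 X₁ * gm1 X₂ - gm1 X₂ * gm1 X₁) -
        (gm1 X₁ * gm1 X₂ - gm1 X₂ * gm1 X₁) * g1m Z
          = gm1 ((4 : ℝ) •
              ((Z 0 * X₁ 0 + Z 1 * X₁ 1) • X₂ - (Z 0 * X₂ 0 + Z 1 * X₂ 1) • X₁))) := by
  intro Z X₁ X₂
  have h : Real.sqrt 2 ^ 2 = 2 := Real.sq_sqrt (by norm_num)
  constructor
  · simp [g1m, gm1, g2mat]
    repeat' apply And.intro
    all_goals first
      | (ext i; fin_cases i <;> rfl)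
      | grind
  · simp [g1m, gm1, g2mat]
    repeat' apply And.intro
    all_goals first
      | (ext i; fin_cases i <;> rfl)
      | grind

end
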